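/- arXiv:1301.6857 — 4 statements merged into one kernel-verified Lean document; each statement's English description precedes it below -/
import Mathlib

section
/- Let X_1, …, X_m be pairwise distinct points in ℝ^d and p_1, …, p_m nonnegative integers. Then the Hermite ideal I(X,p) equals the ideal of ℝ[x_1,…,x_d] generated by all polynomials of the form ∏_{i=1}^m ∏_{j=1}^{p_i+1} l_{i,j}, where each l_{i,j} is a polynomial of total degree at most 1 vanishing at X_i; equivalently, I(X,p) is generated by those polynomials that, for every i = 1,…,m, are divisible by a product of p_i+1 linear polynomials passing through X_i. -/
open MvPolynomial

/-- The iterated partial derivative `∂^α` as a linear endomorphism of `ℝ[x_1,…,x_d]`. -/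
noncomputable def pderivPow {d : ℕ} (α : Fin d → ℕ) :
    Module.End ℝ (MvPolynomial (Fin d) ℝ) :=
  ((List.finRange d).map fun i => ((MvPolynomial.pderiv i).toLinearMap ^ α i)).prod

/-- The Hermite ideal `I(X,p)`, as a set: all polynomials whose partial derivatives of
order up to `p q` all vanish at `X q`, for every `q`. -/
def hermiteSet {d m : ℕ} (X : Fin m → (Fin d → ℝ)) (p : Fin m → ℕ) :
    Set (MvPolynomial (Fin d) ℝ) :=
  {f | ∀ q, ∀ α : Fin d → ℕ, (∑ i, α i) ≤ p q → MvPolynomial.eval (X q) (pderivPow α f) = 0}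

section PointIdeal

variable {d : ℕ}

theorem X_sub_C_mem_ker_eval (x : Fin d → ℝ) (i : Fin d) :
    (X i - C (x i) : MvPolynomial (Fin d) ℝ) ∈ RingHom.ker (eval x) := by
  simp [RingHom.mem_ker]

theorem ker_eval_eq_span (x : Fin d → ℝ) :
    RingHom.ker (eval x) = Ideal.span (Set.range fun i => X i - C (x i)) := by
  refine le_antisymm (fun f hf => ?_) (Ideal.span_le.2 ?_)
  · have key (g : MvPolynomial (Fin d) ℝ) :
        g - C (eval x g) ∈ Ideal.span (Set.range fun i => X i - C (x i)) := by
      induction g using MvPolynomial.induction_on with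
      | C a => simp
      | add g h hg hh => simpa [add_sub_add_comm] using add_mem hg hh
      | mul_X g i hg =>
        have h : g * X i - C (eval x (g * X i)) =
            g * (X i - C (x i)) + (g - C (eval x g)) * C (x i) := by
          rw [map_mul, eval_X, C_mul]
          ring
        rw [h]
        exact add_mem (Ideal.mul_mem_left _ _ (Ideal.subset_span ⟨i, rfl⟩))
          (Ideal.mul_mem_right _ _ hg)
    simpa [RingHom.mem_ker.1 hf] using key f
  · rintro _ ⟨i, rfl⟩
    exact X_sub_C_mem_ker_eval x i

theorem ker_eval_eq_span_linear (x : Fin d → ℝ) :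
    RingHom.ker (eval x) =
      Ideal.span {l : MvPolynomial (Fin d) ℝ | l.totalDegree ≤ 1 ∧ eval x l = 0} := by
  refine le_antisymm ?_ (Ideal.span_le.2 fun l hl => hl.2)
  rw [ker_eval_eq_span]
  refine Ideal.span_mono ?_
  rintro _ ⟨i, rfl⟩
  exact ⟨(totalDegree_sub_C_le _ _).trans (totalDegree_X i).le, by simp⟩

theorem isCoprime_ker_eval {x y : Fin d → ℝ} (h : x ≠ y) :
    IsCoprime (RingHom.ker (eval x)) (RingHom.ker (eval y)) := by
  have hmax (z : Fin d → ℝ) : (RingHom.ker (eval z)).IsMaximal :=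
    RingHom.ker_isMaximal_of_surjective _ fun a => ⟨C a, eval_C a⟩
  have := hmax x
  have := hmax y
  refine Ideal.isCoprime_of_isMaximal fun hxy => h (funext fun i => ?_)
  have hi : (X i - C (x i) : MvPolynomial (Fin d) ℝ) ∈ RingHom.ker (eval y) := by
    rw [← hxy]
    exact X_sub_C_mem_ker_eval x i
  simpa [RingHom.mem_ker, sub_eq_zero, eq_comm] using hi

/-- A derivation lowers the order of vanishing along an ideal by at most one. -/
theorem Derivation.apply_mem_pow {R A : Type*} [CommSemiring R] [CommSemiring A] [Algebra R A]
    (D : Derivation R A A) (I : Ideal A) (n : ℕ) {f : A} (hf : f ∈ I ^ (n + 1)) :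
    D f ∈ I ^ n := by
  induction n generalizing f with
  | zero => simp
  | succ n ih =>
    rw [pow_succ'] at hf
    induction hf using Submodule.mul_induction_on' with
    | mem_mul_mem g hg h hh =>
      rw [D.leibniz, smul_eq_mul, smul_eq_mul]
      refine add_mem ?_ (Ideal.mul_mem_right _ _ hh)
      rw [pow_succ']
      exact Ideal.mul_mem_mul hg (ih hh)
    | add f _ g _ hf hg => rw [map_add]; exact add_mem hf hg

/-- The Euler operator `∑ (X_i - x_i) ∂_i` centred at `x`. -/
noncomputable def eulerAt (x : Fin d → ℝ) :
    Derivation ℝ (MvPolynomial (Fin d) ℝ) (MvPolynomial (Fin d) ℝ) :=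
  ∑ i, (X i - C (x i) : MvPolynomial (Fin d) ℝ) • pderiv i

theorem eulerAt_apply (x : Fin d → ℝ) (f : MvPolynomial (Fin d) ℝ) :
    eulerAt x f = ∑ i, (X i - C (x i)) * pderiv i f := by
  change Derivation.coeFnAddMonoidHom (eulerAt x) f = _
  rw [eulerAt, map_sum, Finset.sum_apply]
  rfl

theorem eulerAt_X_sub_C (x : Fin d → ℝ) (i : Fin d) :
    eulerAt x (X i - C (x i)) = X i - C (x i) := by
  simp [eulerAt_apply, pderiv_X, Pi.single_apply]

theorem eulerAt_mem_pow (x : Fin d → ℝ) (n : ℕ) {f : MvPolynomial (Fin d) ℝ}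
    (hf : f ∈ RingHom.ker (eval x) ^ n) : eulerAt x f ∈ RingHom.ker (eval x) ^ n := by
  rw [eulerAt_apply]
  cases n with
  | zero => simp
  | succ n =>
    refine sum_mem fun i _ => ?_
    rw [pow_succ']
    exact Ideal.mul_mem_mul (X_sub_C_mem_ker_eval x i) ((pderiv i).apply_mem_pow _ n hf)

theorem eulerAt_sub_self_mem_sq (x : Fin d → ℝ) {f : MvPolynomial (Fin d) ℝ}
    (hf : f ∈ RingHom.ker (eval x)) : eulerAt x f - f ∈ RingHom.ker (eval x) ^ 2 := by
  have hspan := hf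
  rw [ker_eval_eq_span] at hspan
  clear hf
  induction hspan using Submodule.span_induction with
  | mem g hg =>
    obtain ⟨i, rfl⟩ := hg
    simp [eulerAt_X_sub_C]
  | zero => simp
  | add g h _ _ hg hh => simpa [add_sub_add_comm] using add_mem hg hh
  | smul a g hg ih =>
    have h : eulerAt x (a • g) - a • g = a * (eulerAt x g - g) + g * eulerAt x a := by
      simp only [smul_eq_mul, Derivation.leibniz]
      ring
    rw [h]
    refine add_mem (Ideal.mul_mem_left _ _ ih) ?_
    rw [sq]
    refine Ideal.mul_mem_mul (by rwa [ker_eval_eq_span]) ?_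
    rw [eulerAt_apply]
    exact sum_mem fun i _ => Ideal.mul_mem_right _ _ (X_sub_C_mem_ker_eval x i)

/-- The Euler operator acts on `I ^ n / I ^ (n + 1)` as multiplication by `n`. -/
theorem eulerAt_sub_nsmul_mem_pow (x : Fin d → ℝ) (n : ℕ) {f : MvPolynomial (Fin d) ℝ}
    (hf : f ∈ RingHom.ker (eval x) ^ n) :
    eulerAt x f - n • f ∈ RingHom.ker (eval x) ^ (n + 1) := by
  induction n generalizing f with
  | zero =>
    rw [zero_smul, sub_zero, zero_add, pow_one, eulerAt_apply]
    exact sum_mem fun i _ => Ideal.mul_mem_right _ _ (X_sub_C_mem_ker_eval x i)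
  | succ n ih =>
    rw [pow_succ'] at hf
    induction hf using Submodule.mul_induction_on' with
    | mem_mul_mem g hg h hh =>
      have key : eulerAt x (g * h) - (n + 1) • (g * h) =
          g * (eulerAt x h - n • h) + (eulerAt x g - g) * h := by
        simp only [Derivation.leibniz, smul_eq_mul, nsmul_eq_mul, Nat.cast_add_one]
        ring
      rw [key]
      refine add_mem ?_ ?_
      · rw [pow_succ']
        exact Ideal.mul_mem_mul hg (ih hh)
      · rw [add_assoc, add_comm, pow_add, one_add_one_eq_two]
        exact Ideal.mul_mem_mul (eulerAt_sub_self_mem_sq x hg) hh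
    | add f _ g _ hf hg => simpa [add_sub_add_comm] using add_mem hf hg

theorem mem_pow_succ_of_pderiv_mem (x : Fin d → ℝ) (n : ℕ) {f : MvPolynomial (Fin d) ℝ}
    (hf : eval x f = 0) (hD : ∀ i, pderiv i f ∈ RingHom.ker (eval x) ^ n) :
    f ∈ RingHom.ker (eval x) ^ (n + 1) := by
  induction n with
  | zero => simpa [RingHom.mem_ker] using hf
  | succ n ih =>
    have hf' := ih fun i => Ideal.pow_le_pow_right n.le_succ (hD i)
    have hE : eulerAt x f ∈ RingHom.ker (eval x) ^ (n + 1 + 1) := by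
      rw [eulerAt_apply, pow_succ']
      exact sum_mem fun i _ => Ideal.mul_mem_mul (X_sub_C_mem_ker_eval x i) (hD i)
    have hn : (n + 1) • f ∈ RingHom.ker (eval x) ^ (n + 1 + 1) := by
      simpa using sub_mem hE (eulerAt_sub_nsmul_mem_pow x (n + 1) hf')
    have := Submodule.smul_of_tower_mem _ ((n + 1 : ℝ)⁻¹) hn
    rwa [← Nat.cast_smul_eq_nsmul ℝ, smul_smul, Nat.cast_add_one,
      inv_mul_cancel₀ (by positivity), one_smul] at this

end PointIdeal

open scoped Pointwise in
theorem Ideal.prod_span_pow {A ι : Type*} [CommSemiring A] [Fintype ι] (S : ι → Set A)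
    (n : ι → ℕ) :
    ∏ i, Ideal.span (S i) ^ n i = Ideal.span {f : A | ∃ l : (i : ι) → Fin (n i) → A,
      (∀ i j, l i j ∈ S i) ∧ f = ∏ i, ∏ j, l i j} := by
  have hpow (i : ι) : Ideal.span (S i) ^ n i = Ideal.span (∏ _j : Fin (n i), S i) := by
    rw [← Ideal.prod_span, Finset.prod_const, Finset.card_univ, Fintype.card_fin]
  rw [Finset.prod_congr rfl fun i _ => hpow i, Ideal.prod_span]
  congr 1
  ext f
  simp only [Set.mem_fintype_prod, Set.mem_ofPred_eq]
  constructor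
  · rintro ⟨g, hg, rfl⟩
    choose l hl hlg using hg
    exact ⟨l, fun i j => hl i j, Finset.prod_congr rfl fun i _ => (hlg i).symm⟩
  · rintro ⟨l, hl, rfl⟩
    exact ⟨fun i => ∏ j, l i j, fun i => ⟨l i, fun j => hl i j, rfl⟩, rfl⟩

section IteratedDerivative

variable {d : ℕ}

theorem pderiv_commute (i j : Fin d) :
    Commute (S := Module.End ℝ (MvPolynomial (Fin d) ℝ))
      (pderiv (R := ℝ) i).toLinearMap (pderiv (R := ℝ) j).toLinearMap := by
  have h : ⁅pderiv (R := ℝ) i, pderiv (R := ℝ) j⁆ = 0 := by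
    refine MvPolynomial.derivation_ext fun k => ?_
    simp [Derivation.commutator_apply, pderiv_X, Pi.single_apply, apply_ite]
  refine LinearMap.ext fun f => ?_
  simpa [Derivation.commutator_apply, sub_eq_zero] using DFunLike.congr_fun h f

theorem List.prod_map_pow_add_single {M ι : Type*} [Monoid M] [DecidableEq ι] {a : ι → M}
    (ha : ∀ i j, Commute (a i) (a j)) (α : ι → ℕ) (i : ι) (l : List ι) (hl : l.Nodup)
    (hi : i ∈ l) :
    (l.map fun j => a j ^ (α + Pi.single i 1 : ι → ℕ) j).prod =
      (l.map fun j => a j ^ α j).prod * a i := by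
  have hni (l : List ι) (h : i ∉ l) :
      (l.map fun j => a j ^ (α + Pi.single i 1 : ι → ℕ) j) = l.map fun j => a j ^ α j := by
    refine List.map_congr_left fun j hj => ?_
    rw [Pi.add_apply, Pi.single_eq_of_ne (ne_of_mem_of_not_mem hj h), add_zero]
  induction l with
  | nil => simp at hi
  | cons b l ih =>
    rw [List.nodup_cons] at hl
    rw [List.map_cons, List.map_cons, List.prod_cons, List.prod_cons]
    obtain rfl | hi := List.mem_cons.1 hi
    · rw [hni l hl.1, Pi.add_apply, Pi.single_eq_same, pow_succ, mul_assoc, mul_assoc]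
      congr 1
      refine Commute.list_prod_right _ _ fun y hy => ?_
      obtain ⟨j, -, rfl⟩ := List.mem_map.1 hy
      exact (ha _ _).pow_right _
    · rw [ih hl.2 hi, Pi.add_apply, Pi.single_eq_of_ne (ne_of_mem_of_not_mem hi hl.1).symm,
        add_zero, mul_assoc]

theorem pderivPow_add_single (α : Fin d → ℕ) (i : Fin d) (f : MvPolynomial (Fin d) ℝ) :
    pderivPow (α + Pi.single i 1) f = pderivPow α (pderiv i f) := by
  rw [pderivPow, List.prod_map_pow_add_single pderiv_commute α i _ (List.nodup_finRange d)
    (List.mem_finRange i)]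
  rfl

theorem pderivPow_zero : pderivPow (0 : Fin d → ℕ) = 1 := by
  simp [pderivPow]

theorem pderivPow_mem_pow (I : Ideal (MvPolynomial (Fin d) ℝ)) (n : ℕ) (α : Fin d → ℕ)
    {f : MvPolynomial (Fin d) ℝ} (hf : f ∈ I ^ (n + ∑ i, α i)) : pderivPow α f ∈ I ^ n := by
  induction hk : ∑ i, α i generalizing α f with
  | zero =>
    obtain rfl : α = 0 := _root_.funext fun i => by simp_all
    simpa [pderivPow_zero] using hf
  | succ k ih =>
    obtain ⟨i, -, hi⟩ := Finset.exists_ne_zero_of_sum_ne_zero (hk.trans_ne k.succ_ne_zero)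
    obtain ⟨β, rfl⟩ : ∃ β, α = β + Pi.single i 1 := by
      refine ⟨α - Pi.single i 1, (tsub_add_cancel_of_le ?_).symm⟩
      intro j
      obtain rfl | hj := eq_or_ne j i
      · simpa using Nat.one_le_iff_ne_zero.2 hi
      · simp [hj]
    simp only [Pi.add_apply, Finset.sum_add_distrib, Finset.sum_pi_single', Finset.mem_univ,
      if_true] at hk hf
    rw [pderivPow_add_single]
    exact ih β ((pderiv i).apply_mem_pow I _ hf) (by omega)

theorem mem_ker_eval_pow_iff (x : Fin d → ℝ) (n : ℕ) (f : MvPolynomial (Fin d) ℝ) :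
    f ∈ RingHom.ker (eval x) ^ (n + 1) ↔
      ∀ α : Fin d → ℕ, ∑ i, α i ≤ n → eval x (pderivPow α f) = 0 := by
  constructor
  · intro hf α hα
    have := pderivPow_mem_pow (RingHom.ker (eval x)) 1 α
      (Ideal.pow_le_pow_right (by omega) hf)
    rwa [pow_one, RingHom.mem_ker] at this
  · intro h
    have hzero : eval x f = 0 := by simpa [pderivPow_zero] using h 0 (by simp)
    induction n generalizing f with
    | zero => simpa [RingHom.mem_ker] using hzero
    | succ n ih =>
      have hD (i : Fin d) (α : Fin d → ℕ) (hα : ∑ j, α j ≤ n) :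
          eval x (pderivPow α (pderiv i f)) = 0 := by
        rw [← pderivPow_add_single]
        refine h _ ?_
        simpa [Finset.sum_add_distrib] using hα
      refine mem_pow_succ_of_pderiv_mem x _ hzero fun i => ih _ (hD i) ?_
      simpa [pderivPow_zero] using hD i 0 (by simp)

end IteratedDerivative

/-- `I(X,p)` is generated by the polynomials which are, for each `i`, products of
`p_i + 1` linear polynomials passing through `X_i`. -/
theorem hermite_ideal_multi_point {d m : ℕ} (X : Fin m → (Fin d → ℝ))
    (hX : Function.Injective X) (p : Fin m → ℕ) :
    hermiteSet X p
      = (Ideal.span {f : MvPolynomial (Fin d) ℝ |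
          ∃ l : (i : Fin m) → Fin (p i + 1) → MvPolynomial (Fin d) ℝ,
            (∀ i j, (l i j).totalDegree ≤ 1 ∧ MvPolynomial.eval (X i) (l i j) = 0) ∧
            f = ∏ i, ∏ j, l i j} : Set (MvPolynomial (Fin d) ℝ)) := by
  have hinf : hermiteSet X p = (⨅ q, RingHom.ker (eval (X q)) ^ (p q + 1) : Ideal _) := by
    ext f
    simp [hermiteSet, mem_ker_eval_pow_iff]
  have hprod : ⨅ q, RingHom.ker (eval (X q)) ^ (p q + 1)
      = ∏ q, RingHom.ker (eval (X q)) ^ (p q + 1) := by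
    simpa using (Ideal.prod_eq_iInf_of_pairwise_isCoprime (s := Finset.univ)
      (J := fun q => RingHom.ker (eval (X q)) ^ (p q + 1))
      fun i _ j _ hij => (isCoprime_ker_eval (hX.ne hij)).pow).symm
  rw [hinf, hprod]
  simp only [ker_eval_eq_span_linear, Ideal.prod_span_pow, Set.mem_ofPred_eq]
end

section
/- Let d ≥ 1, let X_1,…,X_m be pairwise distinct points in ℝ^d, let p_1,…,p_m be nonnegative integers, and suppose the Hermite interpolation problem (X,p) is regular on Π_n^d, i.e., for every family of values c_{q,α} (1 ≤ q ≤ m, |α| ≤ p_q) there exists a unique f ∈ Π_n^d with ∂^α f(X_q) = c_{q,α}. Then for every integer d̃ with 1 ≤ d̃ ≤ d and every choice of s = min(m, d̃+1) distinct indices q_1, …, q_s ∈ {1,…,m}, one has binom(n+d̃, d̃) ≥ Σ_{i=1}^s binom(p_{q_i}+d̃, d̃). -/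
open MvPolynomial

/-- Substitution of the affine map `t ↦ v + L t` into a polynomial. -/
noncomputable def affineSubst {a b : ℕ} (L : (Fin a → ℝ) →ₗ[ℝ] (Fin b → ℝ)) (v : Fin b → ℝ) :
    MvPolynomial (Fin b) ℝ →ₐ[ℝ] MvPolynomial (Fin a) ℝ :=
  aeval fun j => C (v j) + ∑ i, C (L (Pi.single i 1) j) * X i

lemma eval_affineSubst {a b : ℕ} (L : (Fin a → ℝ) →ₗ[ℝ] (Fin b → ℝ)) (v : Fin b → ℝ)
    (t : Fin a → ℝ) (f : MvPolynomial (Fin b) ℝ) :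
    eval t (affineSubst L v f) = eval (v + L t) f := by
  have h : ∀ j, L t j = ∑ i, L (Pi.single i 1) j * t i := fun j => by
    conv_lhs => rw [pi_eq_sum_univ' t]
    simp [mul_comm]
  induction f using MvPolynomial.induction_on with
  | C r => simp [affineSubst]
  | add f g hf hg => simp only [map_add, hf, hg]
  | mul_X f j hf =>
    rw [map_mul, map_mul, hf, map_mul]
    simp [affineSubst, h]

lemma affineSubst_affineSubst {a b c : ℕ} (L : (Fin a → ℝ) →ₗ[ℝ] (Fin b → ℝ)) (v : Fin b → ℝ)
    (M : (Fin b → ℝ) →ₗ[ℝ] (Fin c → ℝ)) (w : Fin c → ℝ) (f : MvPolynomial (Fin c) ℝ) :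
    affineSubst L v (affineSubst M w f) = affineSubst (M ∘ₗ L) (w + M v) f := by
  refine MvPolynomial.funext fun t => ?_
  simp [eval_affineSubst, add_assoc]

lemma affineSubst_id_zero {a : ℕ} (f : MvPolynomial (Fin a) ℝ) :
    affineSubst LinearMap.id 0 f = f :=
  MvPolynomial.funext fun t => by simp [eval_affineSubst]

lemma totalDegree_affineSubst_le {a b : ℕ} (L : (Fin a → ℝ) →ₗ[ℝ] (Fin b → ℝ))
    (v : Fin b → ℝ) (f : MvPolynomial (Fin b) ℝ) :
    (affineSubst L v f).totalDegree ≤ f.totalDegree := by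
  have h1 : ∀ j, (C (v j) + ∑ i, C (L (Pi.single i 1) j) * X i :
      MvPolynomial (Fin a) ℝ).totalDegree ≤ 1 := fun j => by
    refine (totalDegree_add _ _).trans (max_le (by simp) (totalDegree_finsetSum_le fun i _ => ?_))
    exact (totalDegree_mul _ _).trans (by simp)
  rw [affineSubst, aeval_def, eval₂_eq]
  refine totalDegree_finsetSum_le fun s hs => (totalDegree_mul _ _).trans ?_
  rw [algebraMap_eq, totalDegree_C, zero_add]
  refine ((totalDegree_finsetProd _ _).trans (Finset.sum_le_sum fun j _ =>
    (totalDegree_pow _ _).trans (Nat.mul_le_mul_left _ (h1 j)))).trans ?_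
  simpa [Finsupp.sum] using le_totalDegree hs

lemma affineSubst_zero_mem_pow_idealOfVars {a b : ℕ} (L : (Fin a → ℝ) →ₗ[ℝ] (Fin b → ℝ))
    (k : ℕ) {f : MvPolynomial (Fin b) ℝ} (hf : f ∈ idealOfVars (Fin b) ℝ ^ k) :
    affineSubst L 0 f ∈ idealOfVars (Fin a) ℝ ^ k := by
  have h : (idealOfVars (Fin b) ℝ).map (affineSubst L 0) ≤ idealOfVars (Fin a) ℝ := by
    rw [idealOfVars, Ideal.map_span, Ideal.span_le]
    rintro _ ⟨_, ⟨j, rfl⟩, rfl⟩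
    simp only [affineSubst, aeval_X, Pi.zero_apply, map_zero, zero_add, SetLike.mem_coe]
    exact Ideal.sum_mem _ fun i _ => Ideal.mul_mem_left _ _ (Ideal.subset_span ⟨i, rfl⟩)
  have := Ideal.mem_map_of_mem (affineSubst L 0) hf
  rw [Ideal.map_pow] at this
  exact Ideal.pow_right_mono h k this

lemma pderiv_translate {d : ℕ} (v : Fin d → ℝ) (i : Fin d) (f : MvPolynomial (Fin d) ℝ) :
    pderiv i (affineSubst LinearMap.id v f) = affineSubst LinearMap.id v (pderiv i f) := by
  have hX : ∀ j, affineSubst LinearMap.id v (X j) = X j + C (v j) := fun j =>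
    MvPolynomial.funext fun t => by simp [eval_affineSubst, add_comm]
  induction f using MvPolynomial.induction_on with
  | C r => simp [affineSubst]
  | add f g hf hg => simp only [map_add, hf, hg]
  | mul_X f j hf =>
    rw [map_mul, pderiv_mul, pderiv_mul, hf, map_add, map_mul, map_mul, hX]
    by_cases h : i = j
    · subst h; simp
    · simp [pderiv_X_of_ne (Ne.symm h)]

lemma pderivPow_translate {d : ℕ} (v : Fin d → ℝ) (α : Fin d → ℕ) (f : MvPolynomial (Fin d) ℝ) :
    pderivPow α (affineSubst LinearMap.id v f) =
      affineSubst LinearMap.id v (pderivPow α f) := by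
  have hpow : ∀ (i : Fin d) (k : ℕ) (g : MvPolynomial (Fin d) ℝ),
      ((pderiv i).toLinearMap ^ k) (affineSubst LinearMap.id v g) =
        affineSubst LinearMap.id v (((pderiv i).toLinearMap ^ k) g) := by
    intro i k
    induction k with
    | zero => intro g; simp
    | succ k ih =>
      intro g
      rw [pow_succ, Module.End.mul_apply, Module.End.mul_apply, ← ih]
      exact congrArg _ (pderiv_translate v i g)
  unfold pderivPow
  induction List.finRange d with
  | nil => simp
  | cons i l ih =>
    rw [List.map_cons, List.prod_cons, Module.End.mul_apply, ih, hpow, Module.End.mul_apply]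

lemma exists_coeff_pderiv_pow {d : ℕ} (i : Fin d) (k : ℕ) (β : Fin d →₀ ℕ) :
    ∃ K : ℝ, K ≠ 0 ∧ ∀ f : MvPolynomial (Fin d) ℝ,
      coeff β (((pderiv i).toLinearMap ^ k) f) = K * coeff (β + Finsupp.single i k) f := by
  induction k generalizing β with
  | zero => exact ⟨1, one_ne_zero, fun f => by simp⟩
  | succ k ih =>
    obtain ⟨K, hK, h⟩ := ih (β + Finsupp.single i 1)
    refine ⟨(β i + 1) * K, mul_ne_zero (by positivity) hK, fun f => ?_⟩
    rw [pow_succ', Module.End.mul_apply]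
    refine (coeff_pderiv _ _).trans ?_
    rw [h, add_assoc, ← Finsupp.single_add, add_comm 1 k]
    ring

/-- The value of `∂^α f` at the origin is a nonzero multiple of the coefficient of `x^α`. -/
lemma exists_coeff_zero_pderivPow {d : ℕ} (α : Fin d →₀ ℕ) :
    ∃ K : ℝ, K ≠ 0 ∧ ∀ f : MvPolynomial (Fin d) ℝ, coeff 0 (pderivPow α f) = K * coeff α f := by
  have key : ∀ (l : List (Fin d)) (β : Fin d →₀ ℕ), ∃ K : ℝ, K ≠ 0 ∧
      ∀ f : MvPolynomial (Fin d) ℝ,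
        coeff β ((l.map fun i => ((pderiv i).toLinearMap ^ α i)).prod f) =
          K * coeff (β + (l.map fun i => Finsupp.single i (α i)).sum) f := by
    intro l
    induction l with
    | nil => exact fun β => ⟨1, one_ne_zero, fun f => by simp⟩
    | cons i l ih =>
      intro β
      obtain ⟨K, hK, h⟩ := exists_coeff_pderiv_pow i (α i) β
      obtain ⟨K', hK', h'⟩ := ih (β + Finsupp.single i (α i))
      refine ⟨K * K', mul_ne_zero hK hK', fun f => ?_⟩
      rw [List.map_cons, List.prod_cons, Module.End.mul_apply, h, h', List.map_cons,
        List.sum_cons, add_assoc, mul_assoc]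
  obtain ⟨K, hK, h⟩ := key (List.finRange d) 0
  refine ⟨K, hK, fun f => (h f).trans ?_⟩
  have : ((List.finRange d).map fun i => Finsupp.single i (α i)).sum = α := by
    rw [← Fin.sum_univ_def, Finsupp.univ_sum_single]
  rw [this, zero_add]

/-- If all derivatives of `f` of order at most `p` vanish at `v`, then `f (v + ·)` has no terms of
degree at most `p`. -/
lemma translate_mem_pow_idealOfVars {d p : ℕ} (v : Fin d → ℝ) (f : MvPolynomial (Fin d) ℝ)
    (hf : ∀ α : Fin d → ℕ, (∑ i, α i) ≤ p → eval v (pderivPow α f) = 0) :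
    affineSubst LinearMap.id v f ∈ idealOfVars (Fin d) ℝ ^ (p + 1) := by
  rw [mem_pow_idealOfVars_iff']
  intro α hα
  obtain ⟨K, hK, h⟩ := exists_coeff_zero_pderivPow α
  have h0 := hf α (by rw [← Finsupp.degree_eq_sum]; omega)
  have h1 := h (affineSubst LinearMap.id v f)
  rw [pderivPow_translate, ← constantCoeff_eq, ← eval_zero, eval_affineSubst] at h1
  simp only [LinearMap.id_apply, add_zero, h0] at h1
  simpa [hK] using h1.symm

lemma card_degree_le (d k : ℕ) :
    Nat.card {β : Fin d →₀ ℕ | β.degree ≤ k} = (k + d).choose d := by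
  classical
  have h : {β : Fin d →₀ ℕ | β.degree ≤ k} =
      ((Finset.range (k + 1)).biUnion fun j => Finset.univ.finsuppAntidiag j :
        Finset (Fin d →₀ ℕ)) := by
    ext β
    simp [Finset.mem_finsuppAntidiag, Finsupp.degree_eq_sum]
  rw [h, Nat.card_coe_set_eq, Set.ncard_coe_finset, Finset.card_biUnion]
  · simp_rw [Finset.card_finsuppAntidiag_nat_eq_multichoose, Finset.card_univ, Fintype.card_fin]
    exact Nat.sum_range_multichoose k d
  · intro i _ j _ hij
    rw [Function.onFun, Finset.disjoint_left]
    intro β hi hj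
    rw [Finset.mem_finsuppAntidiag] at hi hj
    exact hij (hi.1.symm.trans hj.1)

lemma finite_degree_le (d k : ℕ) : Finite {β : Fin d →₀ ℕ | β.degree ≤ k} :=
  Nat.finite_of_card_ne_zero <| by
    rw [card_degree_le]
    exact (Nat.choose_pos (Nat.le_add_left d k)).ne'

lemma finrank_restrictTotalDegree (d n : ℕ) :
    Module.finrank ℝ (restrictTotalDegree (Fin d) ℝ n) = (n + d).choose d := by
  rw [← card_degree_le d n]
  exact Module.finrank_eq_nat_card_basis (basisRestrictSupport ℝ _)

lemma exists_submodule_finrank_eq {V : Type*} [AddCommGroup V] [Module ℝ V]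
    [FiniteDimensional ℝ V] (W : Submodule ℝ V) {k : ℕ} (hW : Module.finrank ℝ W ≤ k)
    (hk : k ≤ Module.finrank ℝ V) :
    ∃ W' : Submodule ℝ V, W ≤ W' ∧ Module.finrank ℝ W' = k := by
  induction k, hW using Nat.le_induction with
  | base => exact ⟨W, le_rfl, rfl⟩
  | succ k _ ih =>
    obtain ⟨U, hWU, hU⟩ := ih (by omega)
    obtain ⟨v, hv⟩ := U.exists_of_finrank_lt (by omega)
    have hv' : v ∉ U := by simpa using hv 1 one_ne_zero
    exact ⟨U ⊔ Submodule.span ℝ {v}, hWU.trans le_sup_left, by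
      rw [Submodule.finrank_sup_span_singleton hv', hU]⟩

/-- Any `k + 1` points of `ℝ^d` lie on a `k`-dimensional flat, parametrized by `t ↦ v + L t`. -/
lemma exists_flat_parametrization {d k s : ℕ} (hk : k ≤ d) (hs : s ≤ k + 1)
    (x : Fin s → Fin d → ℝ) :
    ∃ (L : (Fin k → ℝ) →ₗ[ℝ] (Fin d → ℝ)) (P : (Fin d → ℝ) →ₗ[ℝ] (Fin k → ℝ)) (v : Fin d → ℝ)
      (t : Fin s → Fin k → ℝ), P ∘ₗ L = LinearMap.id ∧ ∀ i, x i = v + L (t i) := by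
  obtain ⟨v, U, hU, hxU⟩ : ∃ (v : Fin d → ℝ) (U : Submodule ℝ (Fin d → ℝ)),
      Module.finrank ℝ U ≤ k ∧ ∀ i, x i - v ∈ U := by
    cases s with
    | zero => exact ⟨0, ⊥, by simp, fun i => i.elim0⟩
    | succ s =>
      refine ⟨x 0, Submodule.span ℝ (Set.range fun i : Fin s => x i.succ - x 0),
        (finrank_range_le_card _).trans (by simpa using hs), fun i => ?_⟩
      refine Fin.cases (by simp) (fun i => Submodule.subset_span ⟨i, rfl⟩) i
  obtain ⟨W, hUW, hW⟩ := exists_submodule_finrank_eq U hU (by simpa using hk)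
  let e : W ≃ₗ[ℝ] (Fin k → ℝ) := LinearEquiv.ofFinrankEq _ _ (by simp [hW])
  obtain ⟨P, hP⟩ := LinearMap.exists_leftInverse_of_injective (W.subtype ∘ₗ e.symm.toLinearMap)
    (LinearMap.ker_eq_bot.2 (W.injective_subtype.comp e.symm.injective))
  exact ⟨_, P, v, fun i => e ⟨x i - v, hUW (hxU i)⟩, hP, fun i => by simp⟩

/-- If the Hermite interpolation problem `(X,p)` is regular on `Π_n^d`, then for every
`d̃` with `1 ≤ d̃ ≤ d` and every choice of `min (m, d̃+1)` distinct indices,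
`binom(n+d̃,d̃) ≥ Σ binom(p_{q_i}+d̃,d̃)`. -/
theorem regular_implies_binomial_inequality {d m n : ℕ} (hd : 1 ≤ d)
    (X : Fin m → (Fin d → ℝ)) (hX : Function.Injective X) (p : Fin m → ℕ)
    (hreg : ∀ c : Fin m → (Fin d → ℕ) → ℝ, ∃! f : MvPolynomial (Fin d) ℝ,
        f.totalDegree ≤ n ∧ ∀ q, ∀ α : Fin d → ℕ, (∑ i, α i) ≤ p q →
          MvPolynomial.eval (X q) (pderivPow α f) = c q α)
    (d' : ℕ) (hd'1 : 1 ≤ d') (hd'2 : d' ≤ d)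
    (Q : Fin (min m (d' + 1)) → Fin m) (hQ : Function.Injective Q) :
    (∑ i, Nat.choose (p (Q i) + d') d') ≤ Nat.choose (n + d') d' := by
  obtain ⟨L, P, v, t, hPL, hx⟩ :=
    exists_flat_parametrization hd'2 (min_le_right m (d' + 1)) fun i => X (Q i)
  have := fun i => finite_degree_le d' (p (Q i))
  let Φ : restrictTotalDegree (Fin d') ℝ n →ₗ[ℝ]
      ((Σ i, {β : Fin d' →₀ ℕ | β.degree ≤ p (Q i)}) → ℝ) :=
    LinearMap.pi fun z => lcoeff ℝ z.2.1 ∘ₗ (affineSubst LinearMap.id (t z.1)).toLinearMap ∘ₗ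
      Submodule.subtype _
  have hΦ : Function.Surjective Φ := by
    intro c
    have := fun i => Fintype.ofFinite {β : Fin d' →₀ ℕ | β.degree ≤ p (Q i)}
    let g : Fin (min m (d' + 1)) → MvPolynomial (Fin d') ℝ := fun i =>
      ∑ β : {β : Fin d' →₀ ℕ | β.degree ≤ p (Q i)}, monomial β.1 (c ⟨i, β⟩)
    have hg : ∀ i β, coeff β.1 (g i) = c ⟨i, β⟩ := fun i β => by
      classical
      simp [g, coeff_sum, coeff_monomial, Subtype.val_inj]
    let h : Fin m → MvPolynomial (Fin d) ℝ :=
      Function.extend Q (fun i => affineSubst P (-P (X (Q i))) (g i)) 0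
    obtain ⟨f, ⟨hfn, hf⟩, -⟩ := hreg fun q α => eval (X q) (pderivPow α (h q))
    refine ⟨⟨affineSubst L v f, (mem_restrictTotalDegree _ _ _).2
      ((totalDegree_affineSubst_le L v f).trans hfn)⟩, funext fun ⟨i, β⟩ => ?_⟩
    have hmem := affineSubst_zero_mem_pow_idealOfVars L _ <|
      translate_mem_pow_idealOfVars (p := p (Q i)) (X (Q i)) (f - h (Q i)) fun α hα => by
        rw [map_sub, map_sub, hf _ _ hα, sub_self]
    have hzero := (mem_pow_idealOfVars_iff' _ _).1 hmem β.1 (Nat.lt_succ_of_le β.2)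
    have hh : affineSubst L 0 (affineSubst LinearMap.id (X (Q i)) (h (Q i))) = g i := by
      simp only [h, hQ.extend_apply, affineSubst_affineSubst]
      simp [hPL, affineSubst_id_zero]
    rw [map_sub, map_sub, hh, coeff_sub, hg, sub_eq_zero, affineSubst_affineSubst] at hzero
    refine Eq.trans ?_ hzero
    change coeff β.1 (affineSubst LinearMap.id (t i) (affineSubst L v f)) = _
    rw [affineSubst_affineSubst, ← hx]
    simp
  have hle := LinearMap.finrank_le_finrank_of_surjective hΦ
  have := Fintype.ofFinite (Σ i, {β : Fin d' →₀ ℕ | β.degree ≤ p (Q i)})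
  rw [finrank_restrictTotalDegree, Module.finrank_fintype_fun_eq_card, ← Nat.card_eq_fintype_card,
    Nat.card_sigma] at hle
  simpa only [card_degree_le] using hle
end

section
/- Let d ≥ 2 and m ≥ 2, let p_1,…,p_m be nonnegative integers and n a nonnegative integer satisfying binom(n+d,d) = Σ_{q=1}^m binom(p_q+d,d). If p_1 + p_2 + ⋯ + p_m + m ≤ n·d, then for every choice of pairwise distinct points X_1,…,X_m ∈ ℝ^d there exists a nonzero polynomial of total degree at most n which, together with all of its partial derivatives of order up to p_i, vanishes at X_i for every i = 1,…,m. -/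
open MvPolynomial

/-- A derivation lowers the order of vanishing along an ideal by at most one. -/
theorem Derivation.apply_mem_pow_pred {R A : Type*} [CommRing R] [CommRing A] [Algebra R A]
    (D : Derivation R A A) (I : Ideal A) {k : ℕ} {x : A} (hx : x ∈ I ^ k) :
    D x ∈ I ^ (k - 1) := by
  induction k generalizing x with
  | zero => simp
  | succ k ih =>
    rw [pow_succ] at hx
    refine Submodule.mul_induction_on hx (fun a ha b hb => ?_) (fun a b ha hb => ?_)
    · rw [D.leibniz, smul_eq_mul, smul_eq_mul]
      refine add_mem (Ideal.mul_mem_right _ _ ha) ?_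
      rcases k with _ | k
      · simp
      · have := Ideal.mul_mem_mul hb (ih ha)
        rwa [← pow_succ'] at this
    · rw [map_add]
      exact add_mem ha hb

theorem Derivation.pow_apply_mem_pow_sub {R A : Type*} [CommRing R] [CommRing A] [Algebra R A]
    (D : Derivation R A A) (I : Ideal A) {k : ℕ} (a : ℕ) {x : A} (hx : x ∈ I ^ k) :
    (D.toLinearMap ^ a) x ∈ I ^ (k - a) := by
  induction a with
  | zero => simpa using hx
  | succ a ih =>
    rw [pow_succ', Module.End.mul_apply, ← Nat.sub_sub]
    exact D.apply_mem_pow_pred I ih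

theorem pderivPow_apply_mem_pow_sub {d k : ℕ} (I : Ideal (MvPolynomial (Fin d) ℝ))
    (α : Fin d → ℕ) {f : MvPolynomial (Fin d) ℝ} (hf : f ∈ I ^ k) :
    pderivPow α f ∈ I ^ (k - ∑ i, α i) := by
  have key : ∀ L : List (Fin d),
      (L.map fun i => ((MvPolynomial.pderiv (R := ℝ) i).toLinearMap ^ α i)).prod f ∈
        I ^ (k - (L.map α).sum) := by
    intro L
    induction L with
    | nil => simpa using hf
    | cons i L ih =>
      rw [List.map_cons, List.map_cons, List.prod_cons, List.sum_cons, Module.End.mul_apply,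
        add_comm, ← Nat.sub_sub]
      exact (MvPolynomial.pderiv i).pow_apply_mem_pow_sub I (α i) ih
  have := key (List.finRange d)
  rwa [← Fin.sum_univ_def] at this

/-- Any `d` points of `ℝ^d` lie on a common hyperplane. -/
theorem exists_affine_vanishing {d : ℕ} (Y : Fin d → Fin d → ℝ) :
    ∃ l : MvPolynomial (Fin d) ℝ, l ≠ 0 ∧ l.totalDegree ≤ 1 ∧ ∀ r, eval (Y r) l = 0 := by
  let T : (ℝ × (Fin d → ℝ)) →ₗ[ℝ] (Fin d → ℝ) :=
    LinearMap.pi fun r => LinearMap.fst ℝ ℝ (Fin d → ℝ) +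
      ∑ i, Y r i • (LinearMap.proj i).comp (LinearMap.snd ℝ ℝ (Fin d → ℝ))
  obtain ⟨v, hv, hv0⟩ := Submodule.exists_mem_ne_zero_of_ne_bot
    (LinearMap.ker_ne_bot_of_finrank_lt (f := T) (by simp))
  refine ⟨C v.1 + ∑ i, C (v.2 i) * MvPolynomial.X i, fun h0 => hv0 ?_, ?_, fun r => ?_⟩
  · have heval : ∀ y : Fin d → ℝ, v.1 + ∑ i, v.2 i * y i = 0 := fun y => by
      simpa using congrArg (eval y) h0
    have h1 : v.1 = 0 := by simpa using heval 0
    refine Prod.ext h1 (funext fun i => ?_)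
    simpa [h1, Pi.single_apply] using heval (Pi.single i 1)
  · refine (totalDegree_add _ _).trans (max_le (by simp) ?_)
    refine totalDegree_finsetSum_le fun i _ => (totalDegree_mul _ _).trans ?_
    simp
  · have := congrFun (LinearMap.mem_ker.mp hv) r
    simpa [T, mul_comm] using this

/-- McNaughton's wrap-around rule: jobs of lengths `k q ≤ n` with total length at most `n * d`
can be scheduled in `n` time slots on `d` machines, no job running twice in the same slot. -/
theorem exists_wraparound_schedule {d m n : ℕ} [NeZero m] (k : Fin m → ℕ) (hk : ∀ q, k q ≤ n)
    (hsum : ∑ q, k q ≤ n * d) :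
    ∃ s : Fin n → Fin d → Fin m,
      ∀ q, k q ≤ (Finset.univ.filter fun j => ∃ r, s j r = q).card := by
  let job : ℕ → Fin m := fun t =>
    if h : t < ∑ q, k q then (finSigmaFinEquiv.symm ⟨t, h⟩).1 else 0
  refine ⟨fun j r => job (j + n * r), fun q => ?_⟩
  have hslot (i : Fin (k q)) : 0 < n := i.pos.trans_le (hk q)
  let t : Fin (k q) → ℕ := fun i => finSigmaFinEquiv (⟨q, i⟩ : (q : Fin m) × Fin (k q))
  have ht (i : Fin (k q)) : t i < ∑ q, k q := Fin.is_lt _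
  have hjob (i : Fin (k q)) : job (t i) = q := by
    simp only [job, dif_pos (ht i), t, Fin.eta, Equiv.symm_apply_apply]
  have hinj : Function.Injective
      fun i => (⟨t i % n, Nat.mod_lt _ (hslot i)⟩ : Fin n) := by
    intro i j hij
    have hmod : t i % n = t j % n := congrArg Fin.val hij
    simp only [t, finSigmaFinEquiv_apply] at hmod
    have : (i : ℕ) % n = j % n := Nat.ModEq.add_left_cancel' _ hmod
    rw [Nat.mod_eq_of_lt (i.is_lt.trans_le (hk q)),
      Nat.mod_eq_of_lt (j.is_lt.trans_le (hk q))] at this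
    exact Fin.ext this
  calc k q = (Finset.univ.image
        fun i => (⟨t i % n, Nat.mod_lt _ (hslot i)⟩ : Fin n)).card := by
        rw [Finset.card_image_of_injective _ hinj, Finset.card_univ, Fintype.card_fin]
    _ ≤ _ := Finset.card_le_card fun j hj => by
        obtain ⟨i, -, rfl⟩ := Finset.mem_image.mp hj
        refine Finset.mem_filter.mpr ⟨Finset.mem_univ _,
          ⟨t i / n, Nat.div_lt_of_lt_mul ((ht i).trans_le hsum)⟩, ?_⟩
        simp only [Nat.mod_add_div]
        exact hjob i

theorem lt_of_choose_eq_sum_choose {d m n : ℕ} (hm : 2 ≤ m) (p : Fin m → ℕ)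
    (hdim : Nat.choose (n + d) d = ∑ q, Nat.choose (p q + d) d) (q : Fin m) : p q < n := by
  by_contra! h
  have : Nontrivial (Fin m) := Fin.nontrivial_iff_two_le.mpr hm
  obtain ⟨q', hq'⟩ := exists_ne q
  have hlt : Nat.choose (p q + d) d < ∑ q, Nat.choose (p q + d) d :=
    Finset.single_lt_sum (f := fun q => Nat.choose (p q + d) d) hq' (Finset.mem_univ _) (Finset.mem_univ _)
      (Nat.choose_pos (Nat.le_add_left d _)) fun _ _ _ => Nat.zero_le _
  have := Nat.choose_le_choose d (Nat.add_le_add_right h d)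
  lia

/-- If `p_1 + ⋯ + p_m + m ≤ n·d`, then for any pairwise distinct nodes there is a nonzero
polynomial of degree at most `n` vanishing to order `p_i` at each `X_i`. -/
theorem exists_vanishing_polynomial_of_sum_le {d m n : ℕ} (hd : 2 ≤ d) (hm : 2 ≤ m)
    (p : Fin m → ℕ)
    (hdim : Nat.choose (n + d) d = ∑ q, Nat.choose (p q + d) d)
    (hineq : (∑ q, p q) + m ≤ n * d)
    (X : Fin m → (Fin d → ℝ)) (hX : Function.Injective X) :
    ∃ f : MvPolynomial (Fin d) ℝ, f ≠ 0 ∧ f.totalDegree ≤ n ∧ f ∈ hermiteSet X p := by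
  have : NeZero m := ⟨by lia⟩
  obtain ⟨s, hs⟩ := exists_wraparound_schedule (n := n) (d := d) (fun q => p q + 1)
    (lt_of_choose_eq_sum_choose hm p hdim) (by simpa [Finset.sum_add_distrib] using hineq)
  choose l hl0 hldeg hl using fun j => exists_affine_vanishing fun r => X (s j r)
  refine ⟨∏ j, l j, Finset.prod_ne_zero_iff.mpr fun j _ => hl0 j, ?_, fun q α hα => ?_⟩
  · calc (∏ j, l j).totalDegree ≤ ∑ j, (l j).totalDegree := totalDegree_finsetProd _ _
      _ ≤ ∑ _j : Fin n, 1 := Finset.sum_le_sum fun j _ => hldeg j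
      _ = n := by simp
  · let I := RingHom.ker (eval (X q))
    set J := Finset.univ.filter fun j => ∃ r, s j r = q
    have hJ : ∏ j ∈ J, l j ∈ I ^ J.card := by
      rw [← Finset.prod_const]
      refine Ideal.prod_mem_prod fun j hj => ?_
      obtain ⟨r, rfl⟩ := (Finset.mem_filter.mp hj).2
      exact hl j r
    have hf : ∏ j, l j ∈ I ^ (p q + 1) :=
      Ideal.mem_of_dvd _ (Finset.prod_dvd_prod_of_subset _ _ _ (Finset.subset_univ J))
        (Ideal.pow_le_pow_right (hs q) hJ)
    exact Ideal.pow_le_self (by lia) (pderivPow_apply_mem_pow_sub I α hf)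
end

section
/- Let d ≥ 2, m ≥ 2 and k ≥ 1 be integers with m ≤ d + k, let p_1 ≤ p_2 ≤ ⋯ ≤ p_m be nonnegative integers with p_m ≥ 1 and d·p_m ≥ k·(p_m + 1) (i.e., d ≥ k(1 + 1/p_m)), and let n satisfy binom(n+d,d) = Σ_{q=1}^m binom(p_q+d,d). Then the Hermite interpolation scheme is singular: for every choice of pairwise distinct points X_1,…,X_m ∈ ℝ^d there exists a nonzero polynomial f of total degree at most n such that ∂^α f(X_q) = 0 for all 1 ≤ q ≤ m and all multi-indices α with |α| ≤ p_q. -/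
open MvPolynomial

namespace MvPolynomial

/-- The ideal of polynomials vanishing to order at least `r` at the point `x`. -/
noncomputable def vanishingOrderIdeal {d : ℕ} (x : Fin d → ℝ) (r : ℕ) :
    Ideal (MvPolynomial (Fin d) ℝ) :=
  (idealOfVars (Fin d) ℝ ^ r).comap (aeval fun i => X i + C (x i))

theorem mem_vanishingOrderIdeal {d : ℕ} {x : Fin d → ℝ} {r : ℕ} {f : MvPolynomial (Fin d) ℝ} :
    f ∈ vanishingOrderIdeal x r ↔ aeval (fun i => X i + C (x i)) f ∈ idealOfVars (Fin d) ℝ ^ r :=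
  Iff.rfl

theorem coeff_zero_aeval_X_add_C {d : ℕ} (x : Fin d → ℝ) (f : MvPolynomial (Fin d) ℝ) :
    coeff 0 (aeval (fun i => X i + C (x i)) f : MvPolynomial (Fin d) ℝ) = eval x f := by
  have h : (constantCoeff (R := ℝ) (σ := Fin d)).comp
      (aeval (fun i => X i + C (x i)) : _ →ₐ[ℝ] MvPolynomial (Fin d) ℝ).toRingHom = eval x := by
    ext i <;> simp
  exact DFunLike.congr_fun h f

theorem mem_vanishingOrderIdeal_one {d : ℕ} {x : Fin d → ℝ} {f : MvPolynomial (Fin d) ℝ} :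
    f ∈ vanishingOrderIdeal x 1 ↔ eval x f = 0 := by
  rw [mem_vanishingOrderIdeal, mem_pow_idealOfVars_iff', ← coeff_zero_aeval_X_add_C]
  refine ⟨fun h => h 0 (by simp), fun h s hs => ?_⟩
  rw [Nat.lt_one_iff, Finsupp.degree_eq_zero_iff] at hs
  rwa [hs]

theorem vanishingOrderIdeal_antitone {d : ℕ} (x : Fin d → ℝ) :
    Antitone (vanishingOrderIdeal x) :=
  fun _ _ h => Ideal.comap_mono (Ideal.pow_le_pow_right h)

theorem prod_mem_vanishingOrderIdeal {d : ℕ} {ι : Type*} {x : Fin d → ℝ} (s : Finset ι)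
    {f : ι → MvPolynomial (Fin d) ℝ} (hf : ∀ j ∈ s, eval x (f j) = 0) :
    ∏ j ∈ s, f j ∈ vanishingOrderIdeal x s.card := by
  rw [mem_vanishingOrderIdeal, map_prod, ← Finset.prod_const]
  refine Ideal.prod_mem_prod fun j hj => ?_
  simpa [mem_vanishingOrderIdeal] using mem_vanishingOrderIdeal_one.2 (hf j hj)

theorem aeval_X_add_C_pderiv {d : ℕ} (x : Fin d → ℝ) (i : Fin d)
    (f : MvPolynomial (Fin d) ℝ) :
    (aeval (fun i => X i + C (x i)) (pderiv i f) : MvPolynomial (Fin d) ℝ) =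
      pderiv i (aeval (fun i => X i + C (x i)) f) := by
  induction f using MvPolynomial.induction_on with
  | C a => simp
  | add f g hf hg => rw [map_add, map_add, map_add, map_add, hf, hg]
  | mul_X f j hf =>
    simp only [Derivation.leibniz, smul_eq_mul, map_add, map_mul, aeval_X, hf, pderiv_C, add_zero,
      pderiv_X]
    by_cases h : i = j <;> simp [h]

theorem pderiv_mem_pow_idealOfVars {σ : Type*} {r : ℕ} (i : σ) {f : MvPolynomial σ ℝ}
    (hf : f ∈ idealOfVars σ ℝ ^ (r + 1)) : pderiv i f ∈ idealOfVars σ ℝ ^ r := by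
  rw [mem_pow_idealOfVars_iff'] at hf ⊢
  intro s hs
  rw [coeff_pderiv, hf _ (by simpa using hs), zero_mul]

theorem pderiv_mem_vanishingOrderIdeal {d r : ℕ} {x : Fin d → ℝ} (i : Fin d)
    {f : MvPolynomial (Fin d) ℝ} (hf : f ∈ vanishingOrderIdeal x (r + 1)) :
    pderiv i f ∈ vanishingOrderIdeal x r := by
  rw [mem_vanishingOrderIdeal, aeval_X_add_C_pderiv]
  exact pderiv_mem_pow_idealOfVars i hf

theorem pderiv_pow_mem_vanishingOrderIdeal {d r : ℕ} {x : Fin d → ℝ} (i : Fin d) (a : ℕ)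
    {f : MvPolynomial (Fin d) ℝ} (hf : f ∈ vanishingOrderIdeal x (r + a)) :
    ((pderiv i).toLinearMap ^ a : Module.End ℝ (MvPolynomial (Fin d) ℝ)) f ∈
      vanishingOrderIdeal x r := by
  induction a generalizing f with
  | zero => simpa using hf
  | succ a ih =>
    rw [pow_succ, Module.End.mul_apply]
    exact ih (pderiv_mem_vanishingOrderIdeal i hf)

theorem list_prod_pderiv_pow_mem_vanishingOrderIdeal {d r : ℕ} {x : Fin d → ℝ}
    (α : Fin d → ℕ) (l : List (Fin d)) {f : MvPolynomial (Fin d) ℝ}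
    (hf : f ∈ vanishingOrderIdeal x (r + (l.map α).sum)) :
    (l.map fun i => ((pderiv i).toLinearMap ^ α i :
      Module.End ℝ (MvPolynomial (Fin d) ℝ))).prod f ∈ vanishingOrderIdeal x r := by
  induction l generalizing r with
  | nil => simpa using hf
  | cons i l ih =>
    rw [List.map_cons, List.prod_cons, Module.End.mul_apply]
    refine pderiv_pow_mem_vanishingOrderIdeal i (α i) (ih ?_)
    rwa [List.map_cons, List.sum_cons, ← add_assoc] at hf

theorem mem_hermiteSet_of_forall_mem {d m : ℕ} {X : Fin m → (Fin d → ℝ)} {p : Fin m → ℕ}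
    {f : MvPolynomial (Fin d) ℝ} (hf : ∀ q, f ∈ vanishingOrderIdeal (X q) (p q + 1)) :
    f ∈ hermiteSet X p := by
  intro q α hα
  rw [← mem_vanishingOrderIdeal_one]
  refine list_prod_pderiv_pow_mem_vanishingOrderIdeal α (List.finRange d)
    (vanishingOrderIdeal_antitone _ ?_ (hf q))
  rw [← Fin.sum_univ_def]
  omega

theorem sum_range_multichoose (d n : ℕ) :
    ∑ k ∈ Finset.range (n + 1), d.multichoose k = (d + 1).multichoose n := by
  induction n with
  | zero => simp
  | succ n ih => rw [Finset.sum_range_succ, ih, Nat.multichoose_succ_succ, add_comm]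

theorem card_exponents_le (d n : ℕ) :
    Nat.card {s : Fin d →₀ ℕ | (s.sum fun _ e => e) ≤ n} = (n + d).choose d := by
  have h : {s : Fin d →₀ ℕ | (s.sum fun _ e => e) ≤ n} =
      ↑((Finset.range (n + 1)).biUnion fun k =>
        (Finset.univ : Finset (Fin d)).finsuppAntidiag k) := by
    ext s
    simp [Finsupp.sum_fintype]
  rw [h, Nat.card_coe_set_eq, Set.ncard_coe_finset, Finset.card_biUnion]
  · simp only [Finset.card_finsuppAntidiag_nat_eq_multichoose, Finset.card_fin,
      sum_range_multichoose]
    rw [Nat.multichoose_eq, show d + 1 + n - 1 = n + d by omega, Nat.choose_symm_add]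
  · intro a _ b _ hab
    rw [Function.onFun, Finset.disjoint_left]
    intro s hs hs'
    rw [Finset.mem_finsuppAntidiag'] at hs hs'
    exact hab (hs.1.symm.trans hs'.1)

theorem finite_exponents_le (d n : ℕ) : Finite {s : Fin d →₀ ℕ | (s.sum fun _ e => e) ≤ n} :=
  Nat.finite_of_card_ne_zero (by
    rw [card_exponents_le]; exact (Nat.choose_pos (Nat.le_add_left d n)).ne')

theorem finrank_restrictTotalDegree (d n : ℕ) :
    Module.finrank ℝ (restrictTotalDegree (Fin d) ℝ n) = (n + d).choose d := by
  rw [← card_exponents_le d n]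
  exact Module.finrank_eq_nat_card_basis (basisRestrictSupport ℝ _)

/-- If the dimension count is exact, either the interpolation problem has a nontrivial homogeneous
solution, or every jet is interpolated. -/
theorem exists_ne_zero_or_forall_exists_sub_mem {d m n : ℕ} (x : Fin m → Fin d → ℝ)
    (p : Fin m → ℕ) (hdim : (n + d).choose d = ∑ q, (p q + d).choose d) :
    (∃ f : MvPolynomial (Fin d) ℝ, f ≠ 0 ∧ f.totalDegree ≤ n ∧
      ∀ q, f ∈ vanishingOrderIdeal (x q) (p q + 1)) ∨
    ∀ g : Fin m → MvPolynomial (Fin d) ℝ, ∃ f : MvPolynomial (Fin d) ℝ, f.totalDegree ≤ n ∧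
      ∀ q, f - g q ∈ vanishingOrderIdeal (x q) (p q + 1) := by
  have hfin := fun q => finite_exponents_le d (p q)
  let jet (q : Fin m) : MvPolynomial (Fin d) ℝ →ₗ[ℝ]
      ({s : Fin d →₀ ℕ | (s.sum fun _ e => e) ≤ p q} → ℝ) :=
    (LinearMap.pi fun s => lcoeff ℝ s.1) ∘ₗ
      (aeval fun i => X i + C (x q i) : _ →ₐ[ℝ] MvPolynomial (Fin d) ℝ).toLinearMap
  have hjet : ∀ q f, jet q f = 0 → f ∈ vanishingOrderIdeal (x q) (p q + 1) := by
    intro q f hf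
    rw [mem_vanishingOrderIdeal, mem_pow_idealOfVars_iff']
    intro s hs
    exact congrFun hf ⟨s, Nat.lt_succ_iff.1 hs⟩
  let L := (LinearMap.pi jet) ∘ₗ (restrictTotalDegree (Fin d) ℝ n).subtype
  have hrank : Module.finrank ℝ (restrictTotalDegree (Fin d) ℝ n) =
      Module.finrank ℝ (∀ q, {s : Fin d →₀ ℕ | (s.sum fun _ e => e) ≤ p q} → ℝ) := by
    have := fun q => Fintype.ofFinite {s : Fin d →₀ ℕ | (s.sum fun _ e => e) ≤ p q}
    rw [finrank_restrictTotalDegree, hdim, Module.finrank_pi_fintype]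
    refine Finset.sum_congr rfl fun q _ => ?_
    rw [Module.finrank_fintype_fun_eq_card, ← Nat.card_eq_fintype_card, card_exponents_le]
  by_cases hL : Function.Injective L
  · right
    intro g
    obtain ⟨f, hf⟩ := (LinearMap.injective_iff_surjective_of_finrank_eq_finrank hrank).1 hL
      fun q => jet q (g q)
    refine ⟨f, (mem_restrictTotalDegree _ _ _).1 f.2, fun q => hjet q _ ?_⟩
    rw [map_sub, sub_eq_zero]
    exact congrFun hf q
  · left
    rw [← LinearMap.ker_eq_bot] at hL
    obtain ⟨f, hf, hf0⟩ := Submodule.exists_mem_ne_zero_of_ne_bot hL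
    refine ⟨f, by simpa using hf0, (mem_restrictTotalDegree _ _ _).1 f.2, fun q => hjet q _ ?_⟩
    exact congrFun (LinearMap.mem_ker.1 hf) q

/-- Restriction of a polynomial to the parametrised line `t ↦ a + t v`. -/
noncomputable def restrictLine {d : ℕ} (a v : Fin d → ℝ) :
    MvPolynomial (Fin d) ℝ →ₐ[ℝ] Polynomial ℝ :=
  aeval fun i => Polynomial.C (a i) + Polynomial.C (v i) * Polynomial.X

theorem natDegree_restrictLine_le {d n : ℕ} (a v : Fin d → ℝ) {f : MvPolynomial (Fin d) ℝ}
    (hf : f.totalDegree ≤ n) : (restrictLine a v f).natDegree ≤ n := by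
  have h : ∀ i, (Polynomial.C (a i) + Polynomial.C (v i) * Polynomial.X).natDegree ≤ 1 := by
    intro i
    compute_degree
  simpa [restrictLine] using aeval_natDegree_le f hf _ h

theorem dvd_restrictLine {d r : ℕ} (a v : Fin d → ℝ) (t : ℝ) {f : MvPolynomial (Fin d) ℝ}
    (hf : f ∈ vanishingOrderIdeal (a + t • v) r) :
    (Polynomial.X - Polynomial.C t) ^ r ∣ restrictLine a v f := by
  let φ : MvPolynomial (Fin d) ℝ →ₐ[ℝ] Polynomial ℝ :=
    aeval fun i => Polynomial.C (v i) * (Polynomial.X - Polynomial.C t)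
  have hφ : restrictLine a v =
      φ.comp (aeval fun i => X i + C ((a + t • v) i)) := by
    ext1 i
    simp only [restrictLine, φ, aeval_X, AlgHom.comp_apply, map_add, Pi.add_apply, Pi.smul_apply,
      smul_eq_mul, algHom_C, Polynomial.algebraMap_eq, Polynomial.C_mul]
    ring
  have hle : idealOfVars (Fin d) ℝ ≤
      (Ideal.span {Polynomial.X - Polynomial.C t}).comap φ := by
    rw [idealOfVars, Ideal.span_le]
    rintro _ ⟨i, rfl⟩
    simp [φ, Ideal.mem_span_singleton]
  have h := (Ideal.pow_right_mono hle r).trans (Ideal.le_comap_pow _ r) hf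
  rw [Ideal.mem_comap, Ideal.span_singleton_pow, Ideal.mem_span_singleton] at h
  rw [hφ]
  exact h

/-- If the orders at two nodes impose more than `n + 1` conditions on the line joining them, then
the scheme is singular. -/
theorem exists_ne_zero_of_lt_add {d m n : ℕ} {x : Fin m → Fin d → ℝ}
    (hx : Function.Injective x) {p : Fin m → ℕ}
    (hdim : (n + d).choose d = ∑ q, (p q + d).choose d) {a b : Fin m} (hab : a ≠ b)
    (hlt : n < p a + p b + 1) :
    ∃ f : MvPolynomial (Fin d) ℝ, f ≠ 0 ∧ f.totalDegree ≤ n ∧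
      ∀ q, f ∈ vanishingOrderIdeal (x q) (p q + 1) := by
  refine (exists_ne_zero_or_forall_exists_sub_mem x p hdim).resolve_right fun hsurj => ?_
  obtain ⟨i, hi⟩ := Function.ne_iff.1 (hx.ne hab)
  have hvi : x b i - x a i ≠ 0 := sub_ne_zero.2 (Ne.symm hi)
  obtain ⟨f, hfn, hf⟩ := hsurj (Pi.single b ((X i - C (x b i)) ^ p b))
  have ha := hf a
  rw [Pi.single_eq_of_ne hab, sub_zero] at ha
  have hb := hf b
  rw [Pi.single_eq_same] at hb
  set v := x b - x a with hv
  have h0 := dvd_restrictLine (x a) v 0 (r := p a + 1) (f := f) (by simpa using ha)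
  have h1 := dvd_restrictLine (x a) v 1 (r := p b + 1) (by simpa [hv] using hb)
  have hline : restrictLine (x a) v (X i - C (x b i)) =
      Polynomial.C (v i) * (Polynomial.X - Polynomial.C 1) := by
    simp only [restrictLine, map_sub, aeval_X, algHom_C, Polynomial.algebraMap_eq, hv,
      Pi.sub_apply, Polynomial.C_1]
    ring
  rw [map_sub, map_pow, hline, mul_pow] at h1
  have h2 : (Polynomial.X - Polynomial.C (1 : ℝ)) ^ p b ∣ restrictLine (x a) v f :=
    (dvd_iff_dvd_of_dvd_sub ((pow_dvd_pow _ (Nat.le_succ _)).trans h1)).2 (Dvd.intro_left _ rfl)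
  have hcop : IsCoprime ((Polynomial.X - Polynomial.C (0 : ℝ)) ^ (p a + 1))
      ((Polynomial.X - Polynomial.C (1 : ℝ)) ^ p b) :=
    (Polynomial.isCoprime_X_sub_C_of_isUnit_sub (by simp)).pow
  have hzero : restrictLine (x a) v f = 0 := by
    refine Polynomial.eq_zero_of_dvd_of_natDegree_lt (hcop.mul_dvd h0 h2) ?_
    have := natDegree_restrictLine_le (x a) v hfn
    rw [Polynomial.natDegree_mul (pow_ne_zero _ (Polynomial.X_sub_C_ne_zero _))
      (pow_ne_zero _ (Polynomial.X_sub_C_ne_zero _)), Polynomial.natDegree_pow,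
      Polynomial.natDegree_pow, Polynomial.natDegree_X_sub_C, Polynomial.natDegree_X_sub_C]
    omega
  have hC : IsUnit (Polynomial.C (v i) ^ p b) :=
    (Polynomial.isUnit_C.2 (isUnit_iff_ne_zero.2 hvi)).pow _
  rw [hzero, zero_sub, dvd_neg, hC.dvd_mul_left, pow_dvd_pow_iff (Polynomial.X_sub_C_ne_zero _)
      (Polynomial.not_isUnit_X_sub_C _)] at h1
  omega

/-- Through at most `d` points of `ℝ^d` there passes a hyperplane. -/
theorem exists_linear_forall_eval_eq_zero {d m : ℕ} (x : Fin m → Fin d → ℝ)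
    (s : Finset (Fin m)) (hs : s.card ≤ d) :
    ∃ f : MvPolynomial (Fin d) ℝ, f ≠ 0 ∧ f.totalDegree ≤ 1 ∧ ∀ q ∈ s, eval (x q) f = 0 := by
  let L : restrictTotalDegree (Fin d) ℝ 1 →ₗ[ℝ] (s → ℝ) :=
    (LinearMap.pi fun q : s => (aeval (x q)).toLinearMap) ∘ₗ
      (restrictTotalDegree (Fin d) ℝ 1).subtype
  have hL : LinearMap.ker L ≠ ⊥ := by
    apply LinearMap.ker_ne_bot_of_finrank_lt
    rw [finrank_restrictTotalDegree, Module.finrank_fintype_fun_eq_card, Fintype.card_coe,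
      add_comm, Nat.choose_succ_self_right]
    omega
  obtain ⟨f, hf, hf0⟩ := Submodule.exists_mem_ne_zero_of_ne_bot hL
  refine ⟨f, by simpa using hf0, (mem_restrictTotalDegree _ _ _).1 f.2, fun q hq => ?_⟩
  have := congrFun (LinearMap.mem_ker.1 hf) ⟨q, hq⟩
  simpa [L, aeval_eq_eval] using this

/-- Elements with multiplicities `a q ≤ n` and total multiplicity at most `d * n` can be
distributed over `n` sets of cardinality at most `d`. -/
theorem exists_distribution {m n d : ℕ} (a : Fin m → ℕ) (han : ∀ q, a q ≤ n)
    (hsum : ∑ q, a q ≤ d * n) :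
    ∃ S : Fin n → Finset (Fin m), (∀ j, (S j).card ≤ d) ∧
      ∀ q, a q ≤ (Finset.univ.filter fun j => q ∈ S j).card := by
  classical
  rcases Nat.eq_zero_or_pos n with rfl | hn
  · exact ⟨fun _ => ∅, by simp, fun q => by simpa using han q⟩
  let e : (Σ q, Fin (a q)) ≃ Fin (∑ q, a q) := finSigmaFinEquiv
  have hmod : ∀ q (i j : Fin (a q)), (e ⟨q, i⟩ : ℕ) % n = (e ⟨q, j⟩ : ℕ) % n → i = j := by
    intro q i j h
    simp only [e, finSigmaFinEquiv_apply] at h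
    have h' := Nat.ModEq.add_left_cancel' _ h
    exact Fin.ext (h'.eq_of_lt_of_lt (i.2.trans_le (han q)) (j.2.trans_le (han q)))
  refine ⟨fun j => Finset.univ.filter fun q => ∃ i, (e ⟨q, i⟩ : ℕ) % n = j, fun j => ?_,
    fun q => ?_⟩
  · have h : ∀ q : {q // ∃ i, (e ⟨q, i⟩ : ℕ) % n = j}, ∃ i, (e ⟨q.1, i⟩ : ℕ) % n = j :=
      fun q => q.2
    choose i hi using h
    rw [← Fintype.card_subtype, ← Fintype.card_fin d]
    refine Fintype.card_le_of_injective
      (fun q => (⟨(e ⟨q.1, i q⟩ : ℕ) / n, ?_⟩ : Fin d)) fun q q' hqq => ?_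
    · exact Nat.div_lt_of_lt_mul ((e _).2.trans_le (by rwa [mul_comm n]))
    · have hdiv := Fin.mk.inj hqq
      have heq : (e ⟨q.1, i q⟩ : ℕ) = e ⟨q'.1, i q'⟩ := by
        rw [← Nat.div_add_mod (e ⟨q.1, i q⟩ : ℕ) n, ← Nat.div_add_mod (e ⟨q'.1, i q'⟩ : ℕ) n,
          hi, hi, hdiv]
      exact Subtype.ext (congrArg Sigma.fst (e.injective (Fin.ext heq)))
  · rw [← Fintype.card_subtype]
    conv_lhs => rw [← Fintype.card_fin (a q)]
    refine Fintype.card_le_of_injective (fun i => ⟨⟨(e ⟨q, i⟩ : ℕ) % n, Nat.mod_lt _ hn⟩, ?_⟩)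
      fun i j hij => hmod q i j ?_
    · simp only [Finset.mem_filter, Finset.mem_univ, true_and]
      exact ⟨i, rfl⟩
    · exact Fin.mk.inj (Subtype.mk.inj hij)

/-- A product of hyperplanes vanishing to prescribed orders. -/
theorem exists_ne_zero_of_sum_le {d m n : ℕ} (x : Fin m → Fin d → ℝ) (a : Fin m → ℕ)
    (han : ∀ q, a q ≤ n) (hsum : ∑ q, a q ≤ d * n) :
    ∃ f : MvPolynomial (Fin d) ℝ, f ≠ 0 ∧ f.totalDegree ≤ n ∧
      ∀ q, f ∈ vanishingOrderIdeal (x q) (a q) := by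
  obtain ⟨S, hS, haS⟩ := exists_distribution a han hsum
  choose ℓ hne hdeg hvan using fun j => exists_linear_forall_eval_eq_zero x (S j) (hS j)
  refine ⟨∏ j, ℓ j, Finset.prod_ne_zero_iff.2 fun j _ => hne j, ?_, fun q => ?_⟩
  · refine (totalDegree_finsetProd _ _).trans ?_
    simpa using Finset.sum_le_sum fun j (_ : j ∈ Finset.univ) => hdeg j
  · rw [← Finset.prod_filter_mul_prod_filter_not Finset.univ fun j => q ∈ S j]
    exact Ideal.mul_mem_right _ _ (vanishingOrderIdeal_antitone _ (haS q)
      (prod_mem_vanishingOrderIdeal _ fun j hj => hvan j q (Finset.mem_filter.1 hj).2))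

end MvPolynomial

theorem lt_of_choose_eq_sum {d m n : ℕ} (hm : 2 ≤ m) {p : Fin m → ℕ}
    (hdim : Nat.choose (n + d) d = ∑ q, Nat.choose (p q + d) d) (q : Fin m) : p q < n := by
  by_contra! h
  have : Nontrivial (Fin m) := Fin.nontrivial_iff_two_le.2 hm
  obtain ⟨q', hq'⟩ := exists_ne q
  have hlt : Nat.choose (p q + d) d < ∑ q, Nat.choose (p q + d) d :=
    Finset.single_lt_sum (f := fun q => Nat.choose (p q + d) d) hq' (Finset.mem_univ q) (Finset.mem_univ q')
      (Nat.choose_pos (Nat.le_add_left _ _)) fun _ _ _ => Nat.zero_le _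
  have hle : Nat.choose (n + d) d ≤ Nat.choose (p q + d) d :=
    Nat.choose_le_choose d (Nat.add_le_add_right h d)
  omega

theorem sum_succ_le_mul {d m k n : ℕ} (hk : 1 ≤ k) (hmk : m ≤ d + k) {p : Fin m → ℕ}
    {l : Fin m} (hmax : ∀ q, p q ≤ p l)
    (hdk : k * (p l + 1) ≤ d * p l)
    (hn : p l < n) (hpair : ∀ q, q ≠ l → p q + p l + 1 ≤ n) :
    ∑ q, (p q + 1) ≤ d * n := by
  rcases le_or_gt (2 * p l + 1) n with h | h
  · calc ∑ q, (p q + 1) ≤ ∑ _q : Fin m, (p l + 1) :=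
          Finset.sum_le_sum fun q _ => Nat.succ_le_succ (hmax q)
      _ = m * (p l + 1) := by simp
      _ ≤ (d + k) * (p l + 1) := Nat.mul_le_mul_right _ hmk
      _ ≤ d * (2 * p l + 1) := by linarith
      _ ≤ d * n := Nat.mul_le_mul_left d h
  · obtain ⟨j, rfl⟩ := Nat.exists_eq_add_of_le hn.le
    have hrest : ∑ q ∈ Finset.univ.erase l, (p q + 1) ≤ (m - 1) * j := by
      refine (Finset.sum_le_card_nsmul _ _ j fun q hq => ?_).trans (by simp)
      have := hpair q (Finset.ne_of_mem_erase hq)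
      omega
    have hle : (m - 1) * j ≤ (d + (k - 1)) * j := Nat.mul_le_mul_right _ (by omega)
    have hj : (k - 1) * j ≤ (k - 1) * p l := Nat.mul_le_mul_left _ (by omega)
    rw [← Finset.add_sum_erase _ _ (Finset.mem_univ l)]
    obtain ⟨k, rfl⟩ := Nat.exists_eq_add_of_le' hk
    rw [Nat.add_sub_cancel] at hle hj
    nlinarith

/-- All Hermite interpolation schemes of type total degree on `m ≤ d + k` nodes with
`p_m ≥ 1` and `d ≥ k(1 + 1/p_m)` are singular. -/
theorem singular_of_m_le_d_add_k {d m k n : ℕ} (hd : 2 ≤ d) (hm : 2 ≤ m) (hk : 1 ≤ k)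
    (hmk : m ≤ d + k) (p : Fin m → ℕ) (hmono : Monotone p)
    (hpm : 1 ≤ p ⟨m - 1, by omega⟩)
    (hdk : k * (p ⟨m - 1, by omega⟩ + 1) ≤ d * p ⟨m - 1, by omega⟩)
    (hdim : Nat.choose (n + d) d = ∑ q, Nat.choose (p q + d) d)
    (X : Fin m → (Fin d → ℝ)) (hX : Function.Injective X) :
    ∃ f : MvPolynomial (Fin d) ℝ, f ≠ 0 ∧ f.totalDegree ≤ n ∧ f ∈ hermiteSet X p := by
  obtain ⟨l, hl⟩ : ∃ l : Fin m, l = ⟨m - 1, by omega⟩ := ⟨_, rfl⟩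
  rw [← hl] at hdk
  have hmax : ∀ q, p q ≤ p l := fun q => hmono (by rw [hl, Fin.le_def]; simp; omega)
  have hn := lt_of_choose_eq_sum hm hdim
  obtain ⟨f, hf0, hfn, hf⟩ : ∃ f : MvPolynomial (Fin d) ℝ, f ≠ 0 ∧ f.totalDegree ≤ n ∧
      ∀ q, f ∈ vanishingOrderIdeal (X q) (p q + 1) := by
    by_cases hpair : ∀ q, q ≠ l → p q + p l + 1 ≤ n
    · exact exists_ne_zero_of_sum_le X _ hn
        (sum_succ_le_mul hk hmk hmax hdk (hn l) hpair)
    · push Not at hpair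
      obtain ⟨q, hql, hq⟩ := hpair
      exact exists_ne_zero_of_lt_add hX hdim hql hq
  exact ⟨f, hf0, hfn, mem_hermiteSet_of_forall_mem hf⟩
end
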